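/- Let g ≥ 2 and h be integers with h ≥ g^2. Then there exists a partition of ℕ into pairwise disjoint infinite sets W_0, W_1, …, W_{h-1} such that for every r and every w ∈ W_r either w−1 ∈ W_r or w+1 ∈ W_r, and such that A = A_g(W_0) ∪ A_g(W_1) ∪ ⋯ ∪ A_g(W_{h-1}) is NOT a minimal asymptotic basis of order h. (In other words, the answer to the g-adic version of Nathanson's problem is negative for h ≥ g^2.) -/

import Mathlib

/-- `AgSet g W` is the set of all integers of the form `∑ f ∈ F, a f * g ^ f`,
where `F` is a finite nonempty subset of `W` and `1 ≤ a f ≤ g - 1` for each `f ∈ F`. -/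
def AgSet (g : ℕ) (W : Set ℕ) : Set ℕ :=
  {n | ∃ F : Finset ℕ, F.Nonempty ∧ ↑F ⊆ W ∧ ∃ a : ℕ → ℕ,
    (∀ f ∈ F, 1 ≤ a f ∧ a f ≤ g - 1) ∧ n = ∑ f ∈ F, a f * g ^ f}

/-- `FoldSum h A` is the `h`-fold sumset `hA`, the set of all sums `a₁ + ⋯ + a_h`
with each `aᵢ ∈ A`. -/
def FoldSum (h : ℕ) (A : Set ℕ) : Set ℕ :=
  {n | ∃ x : Fin h → ℕ, (∀ i, x i ∈ A) ∧ n = ∑ i, x i}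

/-- `A` is an asymptotic basis of order `h` if every sufficiently large integer lies in `hA`. -/
def IsAsymptoticBasis (h : ℕ) (A : Set ℕ) : Prop :=
  ∀ᶠ n in Filter.atTop, n ∈ FoldSum h A

/-- `A` is a minimal asymptotic basis of order `h` if it is an asymptotic basis of order `h`
and no proper subset of `A` is an asymptotic basis of order `h`. -/
def IsMinimalAsymptoticBasis (h : ℕ) (A : Set ℕ) : Prop :=
  IsAsymptoticBasis h A ∧ ∀ B : Set ℕ, B ⊂ A → ¬ IsAsymptoticBasis h B

/-- The class of a position: the first three positions of each block of five are in class `0`,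
the last two are in one of the classes `1, …, h-1`, cyclically. -/
def posClass (h p : ℕ) : ℕ := if p % 5 < 3 then 0 else 1 + (p / 5) % (h - 1)

theorem agSet_of_digits (g : ℕ) (W : Set ℕ) (d : ℕ → ℕ) (hd : ∀ p, d p < g)
    (S : Finset ℕ) (hS : ∀ p ∈ S, d p ≠ 0 → p ∈ W) :
    ∑ p ∈ S, d p * g ^ p = 0 ∨ ∑ p ∈ S, d p * g ^ p ∈ AgSet g W := by
  classical
  have e : ∑ p ∈ S, d p * g ^ p = ∑ p ∈ S.filter (fun p => d p ≠ 0), d p * g ^ p := by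
    rw [Finset.sum_filter]
    refine Finset.sum_congr rfl fun p _ => ?_
    by_cases h0 : d p = 0 <;> simp [h0]
  rcases Finset.eq_empty_or_nonempty (S.filter (fun p => d p ≠ 0)) with h0 | h0
  · left; rw [e, h0]; simp
  · right
    refine ⟨_, h0, ?_, d, ?_, e⟩
    · intro p hp
      have hp := Finset.mem_filter.1 (Finset.mem_coe.1 hp)
      exact hS p hp.1 hp.2
    · intro p hp
      have hp := Finset.mem_filter.1 hp
      have := hd p
      have := hp.2
      omega

theorem single_mem (g : ℕ) (W : Set ℕ) (f a : ℕ) (hf : f ∈ W) (ha : 1 ≤ a) (ha' : a ≤ g - 1) :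
    a * g ^ f ∈ AgSet g W :=
  ⟨{f}, by simp, by simpa using hf, fun _ => a, by simp; omega, by simp⟩

theorem digits_sum (g n N : ℕ) : n % g ^ N = ∑ p ∈ Finset.range N, (n / g ^ p % g) * g ^ p := by
  induction N with
  | zero => simp [Nat.mod_one]
  | succ k ih => rw [Finset.sum_range_succ, ← ih, Nat.mod_pow_succ]; ring

theorem sum_five (F : ℕ → ℕ) (M : ℕ) : ∑ p ∈ Finset.range (5 * M), F p =
    ∑ j ∈ Finset.range M, (F (5*j) + F (5*j+1) + F (5*j+2) + F (5*j+3) + F (5*j+4)) := by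
  induction M with
  | zero => simp
  | succ k ih =>
    rw [Finset.sum_range_succ, ← ih, show 5 * (k+1) = 5*k+1+1+1+1+1 by ring]
    simp only [Finset.sum_range_succ]
    ring

theorem block_mem (g : ℕ) (hg : 2 ≤ g) (W : Set ℕ) (hW : ∀ p, p % 5 < 3 → p ∈ W) (M : ℕ)
    (w : ℕ → ℕ) (hw : ∀ j, w j < g ^ 3) :
    ∑ j ∈ Finset.range M, w j * g ^ (5 * j) = 0 ∨
    ∑ j ∈ Finset.range M, w j * g ^ (5 * j) ∈ AgSet g W := by
  have key := agSet_of_digits g W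
    (fun p => if p % 5 < 3 then (w (p / 5) / g ^ (p % 5)) % g else 0)
    (by intro p; split_ifs
        · exact Nat.mod_lt _ (by omega)
        · omega) (Finset.range (5 * M))
    (by intro p _ h; by_contra h2; have := mt (hW p) h2; simp [this] at h)
  rw [sum_five] at key
  have e : ∀ j, w j = w j % g + (w j / g % g) * g + (w j / g ^ 2 % g) * g ^ 2 := by
    intro j
    have := digits_sum g (w j) 3
    rw [Nat.mod_eq_of_lt (hw j)] at this
    simpa [Finset.sum_range_succ] using this
  have e2 : ∀ j, w j * g ^ (5 * j) =
      (w j % g + (w j / g % g) * g + (w j / g ^ 2 % g) * g ^ 2) * g ^ (5 * j) := by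
    intro j; rw [← e j]
  rw [Finset.sum_congr rfl (fun j _ => e2 j)]
  convert key using 2
  all_goals
    try rw [eq_iff_iff]
  all_goals
    have E : ∀ j, (w j % g + (w j / g % g) * g + (w j / g ^ 2 % g) * g ^ 2) * g ^ (5 * j) =
      ((if 5 * j % 5 < 3 then w (5 * j / 5) / g ^ (5 * j % 5) % g else 0) * g ^ (5 * j) +
      (if (5 * j + 1) % 5 < 3 then w ((5 * j + 1) / 5) / g ^ ((5 * j + 1) % 5) % g else 0) *
        g ^ (5 * j + 1) +
      (if (5 * j + 2) % 5 < 3 then w ((5 * j + 2) / 5) / g ^ ((5 * j + 2) % 5) % g else 0) *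
        g ^ (5 * j + 2) +
      (if (5 * j + 3) % 5 < 3 then w ((5 * j + 3) / 5) / g ^ ((5 * j + 3) % 5) % g else 0) *
        g ^ (5 * j + 3) +
      (if (5 * j + 4) % 5 < 3 then w ((5 * j + 4) / 5) / g ^ ((5 * j + 4) % 5) % g else 0) *
        g ^ (5 * j + 4)) := by
      intro j
      have a0 : 5 * j % 5 = 0 := by omega
      have a1 : (5 * j + 1) % 5 = 1 := by omega
      have a2 : (5 * j + 2) % 5 = 2 := by omega
      have a3 : (5 * j + 3) % 5 = 3 := by omega
      have a4 : (5 * j + 4) % 5 = 4 := by omega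
      have b0 : 5 * j / 5 = j := by omega
      have b1 : (5 * j + 1) / 5 = j := by omega
      have b2 : (5 * j + 2) / 5 = j := by omega
      rw [a0, a1, a2, a3, a4, b0, b1, b2]
      norm_num
      ring
  · exact Finset.sum_congr rfl fun j _ => E j
  · exact Finset.sum_congr rfl fun j _ => E j

/-- The union of all `AgSet g (W r)`. -/
def bigA (g h : ℕ) : Set ℕ := ⋃ r ∈ Finset.range h, AgSet g {p | posClass h p = r}

theorem mem_bigA (g h x : ℕ) : x ∈ bigA g h ↔ ∃ r < h, x ∈ AgSet g {p | posClass h p = r} := by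
  simp [bigA]

theorem posClass_lt (h p : ℕ) (hh : 4 ≤ h) : posClass h p < h := by
  unfold posClass
  have := Nat.mod_lt (p / 5) (show 0 < h - 1 by omega)
  split_ifs <;> omega

theorem split_mem (g h : ℕ) (hg : 2 ≤ g) (hh : 4 ≤ h) (x : ℕ) (hx : x ∈ bigA g h)
    (hx3 : g ^ 3 ≤ x) :
    ∃ y z, y ∈ bigA g h ∧ z ∈ bigA g h ∧ y ≠ g ∧ z ≠ g ∧ x = y + z := by
  classical
  have g3 : g < g ^ 3 := by nlinarith [pow_two g, pow_succ g 2]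
  obtain ⟨r, hr, F, hF, hFW, a, ha, rfl⟩ := (mem_bigA _ _ _).1 hx
  have single : ∀ f b, 1 ≤ b → b ≤ g - 1 → b * g ^ f ∈ bigA g h := fun f b h1 h2 =>
    (mem_bigA _ _ _).2 ⟨posClass h f, posClass_lt h f hh, single_mem g _ f b rfl h1 h2⟩
  -- an element at position at least three
  obtain ⟨f, hf, hf3⟩ : ∃ f ∈ F, 3 ≤ f := by
    by_contra hcon
    push Not at hcon
    have h1 : ∑ f ∈ F, a f * g ^ f ≤ ∑ f ∈ F, (g - 1) * g ^ f :=
      Finset.sum_le_sum fun f hf => Nat.mul_le_mul_right _ (ha f hf).2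
    have h2 : ∑ f ∈ F, (g - 1) * g ^ f ≤ ∑ f ∈ Finset.range 3, (g - 1) * g ^ f :=
      Finset.sum_le_sum_of_subset fun f hf => Finset.mem_range.2 (hcon f hf)
    have h3 : ∑ f ∈ Finset.range 3, (g - 1) * g ^ f < g ^ 3 := by
      obtain ⟨k, rfl⟩ : ∃ k, g = k + 1 := ⟨g - 1, by omega⟩
      simp only [Finset.sum_range_succ, Finset.sum_range_zero, Nat.add_sub_cancel]
      nlinarith
    omega
  have big : ∀ b m, 1 ≤ b → g < b * g ^ f + m := by
    intro b m hb
    have : g ^ 3 ≤ g ^ f := Nat.pow_le_pow_right (by omega) hf3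
    nlinarith
  have big0 : ∀ b, 1 ≤ b → g < b * g ^ f := fun b hb => by simpa using big b 0 hb
  have haf := ha f hf
  rw [← Finset.add_sum_erase F _ hf]
  rcases Finset.eq_empty_or_nonempty (F.erase f) with h0 | h0
  · rw [h0, Finset.sum_empty, add_zero]
    by_cases h1 : a f = 1
    · obtain ⟨e, rfl⟩ : ∃ e, f = e + 1 := ⟨f - 1, by omega⟩
      have he : g ^ 2 ≤ g ^ e := Nat.pow_le_pow_right (by omega) (by omega)
      have h2 : g < g ^ e := by nlinarith
      refine ⟨(g - 1) * g ^ e, 1 * g ^ e, single _ _ (by omega) (by omega),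
        single _ _ (by omega) (by omega), ?_, by omega, ?_⟩
      · have : 1 * g ^ e ≤ (g - 1) * g ^ e := Nat.mul_le_mul_right _ (by omega)
        omega
      · rw [h1, ← add_mul, Nat.sub_add_cancel (by omega), pow_succ]; ring
    · refine ⟨1 * g ^ f, (a f - 1) * g ^ f, single _ _ (by omega) (by omega),
        single _ _ (by omega) (by omega), (big0 _ (by omega)).ne', (big0 _ (by omega)).ne', ?_⟩
      rw [← add_mul]; congr 1; omega
  · by_cases hrest : ∑ x ∈ F.erase f, a x * g ^ x = g
    · obtain ⟨e, he⟩ := h0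
      have heF := Finset.mem_of_mem_erase he
      have h1 : a e * g ^ e ≤ g := by
        refine le_of_le_of_eq ?_ hrest
        exact Finset.single_le_sum (f := fun x => a x * g ^ x) (fun _ _ => Nat.zero_le _) he
      have he3 : e < 3 := by
        by_contra hc
        have : g ^ 3 ≤ g ^ e := Nat.pow_le_pow_right (by omega) (by omega)
        have := (ha e heF).1
        nlinarith
      have hr0 : r = 0 := by
        have : posClass h e = r := hFW heF
        rw [← this]
        unfold posClass
        rw [if_pos (by omega)]
      have hfr : posClass h f = r := hFW hf
      have c0 : posClass h 0 = 0 := by simp [posClass]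
      refine ⟨a f * g ^ f + 1, (g - 1) * g ^ 0, ?_, single _ _ (by omega) (by omega),
        (big _ _ haf.1).ne', by simp; omega, by rw [hrest]; simp; omega⟩
      refine (mem_bigA _ _ _).2 ⟨0, by omega, {f, 0}, by simp, ?_,
        fun x => if x = 0 then 1 else a f, ?_, ?_⟩
      · intro p hp
        simp at hp
        rcases hp with rfl | rfl
        · simpa [hr0] using hfr
        · exact c0
      · intro p hp
        dsimp only
        split_ifs <;> omega
      · rw [Finset.sum_pair (by omega)]
        simp [show f ≠ 0 by omega]
    · refine ⟨_, _, single f (a f) haf.1 haf.2, ?_, (big0 _ haf.1).ne', hrest, rfl⟩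
      exact (mem_bigA _ _ _).2 ⟨r, hr, _, h0, fun p hp =>
        hFW (Finset.mem_of_mem_erase (Finset.mem_coe.1 hp)), a,
        fun p hp => ha p (Finset.mem_of_mem_erase hp), rfl⟩

theorem fold_mem (g h : ℕ) (hg : 2 ≤ g) (hh : 4 ≤ h) (k : ℕ) : ∀ (x : Fin h → ℕ),
    (∀ i, x i = 0 ∨ x i ∈ bigA g h \ {g}) → h * g ^ 3 ≤ ∑ i, x i →
    (Finset.univ.filter (fun i => x i = 0)).card = k →
    ∑ i, x i ∈ FoldSum h (bigA g h \ {g}) := by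
  classical
  induction k with
  | zero =>
    intro x hx _ hk
    refine ⟨x, fun i => ?_, rfl⟩
    rcases hx i with h0 | h0
    · have : i ∈ (∅ : Finset (Fin h)) := by
        rw [← Finset.card_eq_zero.1 hk]; simp [h0]
      simp at this
    · exact h0
  | succ k ih =>
    intro x hx hn hk
    obtain ⟨i, hi⟩ : (Finset.univ.filter (fun i => x i = 0)).Nonempty := by
      rw [← Finset.card_pos]; omega
    have hi0 : x i = 0 := by simpa using hi
    have gpos : 0 < g ^ 3 := by positivity
    obtain ⟨j, hj⟩ : ∃ j, g ^ 3 ≤ x j := by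
      by_contra hc
      push Not at hc
      have : ∑ j, x j < ∑ _j : Fin h, g ^ 3 :=
        Finset.sum_lt_sum (fun j _ => (hc j).le) ⟨i, Finset.mem_univ _, hc i⟩
      simp at this
      omega
    have hij : i ≠ j := by rintro rfl; omega
    have hjA : x j ∈ bigA g h := by
      rcases hx j with h0 | h0
      · omega
      · exact h0.1
    obtain ⟨y, z, hy, hz, hyg, hzg, hyz⟩ := split_mem g h hg hh _ hjA hj
    have pos : ∀ y ∈ bigA g h, y ≠ 0 := by
      intro y hy
      obtain ⟨r, -, F, ⟨f, hf⟩, -, a, ha, rfl⟩ := (mem_bigA _ _ _).1 hy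
      have : 0 < a f * g ^ f := Nat.mul_pos (ha f hf).1 (by positivity)
      have := Finset.single_le_sum (f := fun x => a x * g ^ x) (fun _ _ => Nat.zero_le _) hf
      omega
    let x' : Fin h → ℕ := fun l => if l = i then y else if l = j then z else x l
    have hsum : ∑ l, x' l = ∑ l, x l := by
      have hji : j ∈ Finset.univ.erase i := by simp [hij.symm]
      rw [← Finset.add_sum_erase _ x (Finset.mem_univ i),
        ← Finset.add_sum_erase _ x' (Finset.mem_univ i),
        ← Finset.add_sum_erase _ x hji, ← Finset.add_sum_erase _ x' hji]
      have : ∑ l ∈ (Finset.univ.erase i).erase j, x' l =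
          ∑ l ∈ (Finset.univ.erase i).erase j, x l := by
        refine Finset.sum_congr rfl fun l hl => ?_
        simp at hl
        simp [x', hl]
      rw [this]
      simp [x', hij.symm, hi0, hyz]
      ring
    rw [← hsum]
    apply ih x'
    · intro l
      by_cases h1 : l = i
      · right; simp [x', h1]; exact ⟨hy, hyg⟩
      · by_cases h2 : l = j
        · right; simp [x', h2, hij.symm]; exact ⟨hz, hzg⟩
        · simpa [x', h1, h2] using hx l
    · rw [hsum]; exact hn
    · have : Finset.univ.filter (fun l => x' l = 0) =
          (Finset.univ.filter (fun l => x l = 0)).erase i := by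
        ext l
        by_cases h1 : l = i
        · simp [x', h1, pos y hy]
        · by_cases h2 : l = j
          · simp [x', h2, hij.symm, pos z hz, pos _ hjA]
          · simp [x', h1, h2]
      rw [this, Finset.card_erase_of_mem hi]
      omega

theorem basis_erase (g h : ℕ) (hg : 2 ≤ g) (hh : g ^ 2 ≤ h) (n : ℕ) (hn : h * g ^ 3 ≤ n) :
    n ∈ FoldSum h (bigA g h \ {g}) := by
  classical
  have h4 : 4 ≤ h := by nlinarith
  have g3 : g + g ^ 2 ≤ g ^ 3 := by nlinarith [pow_two g, pow_succ g 2]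
  have g2 : 4 ≤ g ^ 2 := by nlinarith
  have hng : g < n := by nlinarith
  set d : ℕ → ℕ := fun p => n / g ^ p % g with hd
  have hdlt : ∀ p, d p < g := fun p => Nat.mod_lt _ (by omega)
  have hsum : n = ∑ p ∈ Finset.range (5 * n), d p * g ^ p := by
    rw [← digits_sum, Nat.mod_eq_of_lt]
    exact lt_of_lt_of_le (Nat.lt_pow_self (by omega)) (Nat.pow_le_pow_right (by omega) (by omega))
  let part : ℕ → ℕ := fun r =>
    ∑ p ∈ (Finset.range (5 * n)).filter (fun p => posClass h p = r), d p * g ^ p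
  have hpart : ∑ r ∈ Finset.range h, part r = n := by
    conv_rhs => rw [hsum]
    exact Finset.sum_fiberwise_of_maps_to
      (fun p _ => Finset.mem_range.2 (posClass_lt h p h4)) _
  have hmem : ∀ r, part r = 0 ∨ part r ∈ AgSet g {p | posClass h p = r} := by
    intro r
    exact agSet_of_digits g _ d hdlt _ (fun p hp _ => (Finset.mem_filter.1 hp).2)
  by_cases hcase : ∀ r < h, part r ≠ g
  · have e : n = ∑ i : Fin h, part i := by rw [← Finset.sum_range, hpart]
    rw [e]
    refine fold_mem g h hg h4 _ _ (fun i => ?_) (by rw [← e]; exact hn) rfl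
    rcases hmem i with h0 | h0
    · exact Or.inl h0
    · exact Or.inr ⟨(mem_bigA _ _ _).2 ⟨i, i.2, h0⟩, hcase i i.2⟩
  · push Not at hcase
    obtain ⟨r, hr, hrg⟩ := hcase
    have hr0 : r = 0 := by
      by_contra hr0
      have : g ^ 3 ∣ part r := by
        refine Finset.dvd_sum fun p hp => Dvd.dvd.mul_left (pow_dvd_pow _ ?_) _
        have := (Finset.mem_filter.1 hp).2
        by_contra hc
        unfold posClass at this
        rw [if_pos (by omega)] at this
        omega
      rw [hrg] at this
      have := Nat.le_of_dvd (by omega) this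
      omega
    subst hr0
    let v : ℕ → ℕ := fun j => d (5 * j + 3) + g * d (5 * j + 4)
    have hv : ∀ j, v j < g ^ 2 := by
      intro j
      have h1 := hdlt (5 * j + 3)
      have h2 := hdlt (5 * j + 4)
      simp only [v]
      nlinarith
    have hn2 : n = g + ∑ j ∈ Finset.range n, g ^ 3 * (v j * g ^ (5 * j)) := by
      conv_lhs => rw [hsum]
      rw [← Finset.sum_filter_add_sum_filter_not (Finset.range (5 * n))
        (fun p => posClass h p = 0)]
      change part 0 + _ = _
      rw [hrg, Finset.sum_filter, sum_five]
      congr 1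
      refine Finset.sum_congr rfl fun j _ => ?_
      have c0 : posClass h (5 * j) = 0 := by unfold posClass; rw [if_pos (by omega)]
      have c1 : posClass h (5 * j + 1) = 0 := by unfold posClass; rw [if_pos (by omega)]
      have c2 : posClass h (5 * j + 2) = 0 := by unfold posClass; rw [if_pos (by omega)]
      have c3 : posClass h (5 * j + 3) ≠ 0 := by unfold posClass; rw [if_neg (by omega)]; omega
      have c4 : posClass h (5 * j + 4) ≠ 0 := by unfold posClass; rw [if_neg (by omega)]; omega
      simp only [c0, c1, c2, c3, c4, not_true_eq_false, not_false_eq_true, if_true, if_false, v]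
      ring
    let X : ℕ → ℕ := fun i => if i = 0 then g + ∑ j ∈ Finset.range n, v j * g ^ (5 * j)
      else ∑ j ∈ Finset.range n, (if i ≤ v j then g ^ 3 - 1 else 0) * g ^ (5 * j)
    have hW : ∀ p, p % 5 < 3 → p ∈ {p | posClass h p = 0} := by
      intro p hp
      change posClass h p = 0
      unfold posClass
      rw [if_pos hp]
    obtain ⟨H, rfl⟩ : ∃ H, h = H + 1 := ⟨h - 1, by omega⟩
    have hX : ∑ i : Fin (H + 1), X i = n := by
      rw [← Finset.sum_range (f := X), Finset.sum_range_succ']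
      simp only [X, if_true, Nat.succ_ne_zero, if_false]
      rw [Finset.sum_comm, add_comm, add_assoc, ← Finset.sum_add_distrib]
      conv_rhs => rw [hn2]
      congr 1
      refine Finset.sum_congr rfl fun j _ => ?_
      have hc : ∑ i ∈ Finset.range H, (if i + 1 ≤ v j then g ^ 3 - 1 else 0) =
          v j * (g ^ 3 - 1) := by
        rw [← Finset.sum_filter]
        have : (Finset.range H).filter (fun i => i + 1 ≤ v j) = Finset.range (v j) := by
          ext i
          have := hv j
          simp
          omega
        rw [this]
        simp
      rw [← Finset.sum_mul, hc, ← add_mul, ← mul_assoc]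
      congr 1
      obtain ⟨k, hk⟩ : ∃ k, g ^ 3 = k + 1 := ⟨g ^ 3 - 1, by omega⟩
      rw [hk, Nat.add_sub_cancel]
      ring
    rw [← hX]
    refine fold_mem g (H + 1) hg h4 _ (fun i => X i) (fun i => ?_) (by rw [hX]; exact hn) rfl
    by_cases hi : (i : ℕ) = 0
    · have e : X i = ∑ j ∈ Finset.range n, (v j + if j = 0 then g else 0) * g ^ (5 * j) := by
        simp only [X, hi, if_true, add_mul, Finset.sum_add_distrib, ite_mul, zero_mul]
        rw [Finset.sum_ite_eq' ]
        simp [show 0 < n by omega]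
        ring
      have hne : X i ≠ g := by
        intro hXg
        simp only [X, hi, if_true] at hXg
        have : ∑ j ∈ Finset.range n, v j * g ^ (5 * j) = 0 := by omega
        rw [← Finset.mul_sum, this] at hn2
        omega
      have := block_mem g hg _ hW n (fun j => v j + if j = 0 then g else 0) (by
        intro j
        have := hv j
        split_ifs <;> omega)
      rw [← e] at this
      rcases this with h0 | h0
      · exact Or.inl h0
      · exact Or.inr ⟨(mem_bigA _ _ _).2 ⟨0, by omega, h0⟩, hne⟩
    · have e : X i = ∑ j ∈ Finset.range n,
          (if (i : ℕ) ≤ v j then g ^ 3 - 1 else 0) * g ^ (5 * j) := by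
        simp only [X, hi, if_false]
      have hne : X i ≠ g := by
        intro hXg
        have : g ^ 3 - 1 ∣ X i := by
          rw [e]
          refine Finset.dvd_sum fun j _ => Dvd.dvd.mul_right ?_ _
          split_ifs <;> simp
        rw [hXg] at this
        have := Nat.le_of_dvd (by omega) this
        omega
      have := block_mem g hg _ hW n (fun j => if (i : ℕ) ≤ v j then g ^ 3 - 1 else 0) (by
        intro j
        split_ifs <;> omega)
      rw [← e] at this
      rcases this with h0 | h0
      · exact Or.inl h0
      · exact Or.inr ⟨(mem_bigA _ _ _).2 ⟨0, by omega, h0⟩, hne⟩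

/-- Let `g ≥ 2` and `h ≥ g ^ 2`. Then there is a partition of ℕ into pairwise
disjoint infinite sets `W 0, …, W (h-1)` such that every `w ∈ W r` has `w - 1 ∈ W r` or
`w + 1 ∈ W r`, and `A = A_g(W 0) ∪ ⋯ ∪ A_g(W (h-1))` is not a minimal asymptotic basis of
order `h`. -/
theorem stmt7 (g h : ℕ) (hg : 2 ≤ g) (hh : g ^ 2 ≤ h) :
    ∃ W : ℕ → Set ℕ,
      (⋃ r ∈ Finset.range h, W r) = Set.univ ∧
      (∀ r < h, ∀ s < h, r ≠ s → Disjoint (W r) (W s)) ∧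
      (∀ r < h, (W r).Infinite) ∧
      (∀ r < h, ∀ w ∈ W r, (∃ v : ℕ, v + 1 = w ∧ v ∈ W r) ∨ w + 1 ∈ W r) ∧
      ¬ IsMinimalAsymptoticBasis h (⋃ r ∈ Finset.range h, AgSet g (W r)) := by
  have h4 : 4 ≤ h := by nlinarith
  refine ⟨fun r => {p | posClass h p = r}, ?_, ?_, ?_, ?_, ?_⟩
  · ext p
    simpa using posClass_lt h p h4
  · intro r _ s _ hrs
    rw [Set.disjoint_left]
    intro p hp hp'
    exact hrs (hp.symm.trans hp')
  · intro r hr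
    rw [Set.infinite_iff_exists_gt]
    intro N
    by_cases h0 : r = 0
    · refine ⟨5 * (N + 1), ?_, by omega⟩
      change posClass h _ = r
      unfold posClass
      rw [if_pos (by omega), h0]
    · refine ⟨5 * ((r - 1) + (h - 1) * (N + 1)) + 3, ?_, by nlinarith [show 1 ≤ h - 1 by omega]⟩
      change posClass h _ = r
      unfold posClass
      rw [if_neg (by omega),
        show (5 * ((r - 1) + (h - 1) * (N + 1)) + 3) / 5 = (r - 1) + (h - 1) * (N + 1) by omega,
        Nat.add_mul_mod_self_left, Nat.mod_eq_of_lt (by omega)]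
      omega
  · intro r _ w hw
    have hw : posClass h w = r := hw
    by_cases hc : w % 5 = 0 ∨ w % 5 = 3
    · right
      change posClass h (w + 1) = r
      rw [← hw]
      unfold posClass
      rw [show (w + 1) / 5 = w / 5 by omega]
      rcases hc with hc | hc
      · rw [if_pos (by omega), if_pos (by omega)]
      · rw [if_neg (by omega), if_neg (by omega)]
    · left
      refine ⟨w - 1, by omega, ?_⟩
      change posClass h (w - 1) = r
      rw [← hw]
      unfold posClass
      rw [show (w - 1) / 5 = w / 5 by omega]
      by_cases h3 : w % 5 < 3
      · rw [if_pos (by omega), if_pos (by omega)]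
      · rw [if_neg (by omega), if_neg (by omega)]
  · rintro ⟨-, hmin⟩
    change ∀ B : Set ℕ, B ⊂ bigA g h → _ at hmin
    refine hmin (bigA g h \ {g}) ?_ ?_
    · refine Set.sdiff_singleton_ssubset.2 ((mem_bigA _ _ _).2 ⟨0, by omega, ?_⟩)
      have := single_mem g {p | posClass h p = 0} 1 1 (by simp [posClass]) le_rfl (by omega)
      simpa using this
    · exact Filter.eventually_atTop.2 ⟨h * g ^ 3, fun n hn => basis_erase g h hg hh n hn⟩
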